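/- arXiv:2405.09360 — 7 statements merged into one kernel-verified Lean document; each statement's English description precedes it below -/
import Mathlib

section
/- Assume that |PD(Y=0, Ŷ=0)| + |PD(Y=1, Ŷ=1)| > 0. Then for every K > 0 there exist real utilities U₀₀, U₀₁, U₁₀, U₁₁ such that the resulting utility difference satisfies UD ≥ K. -/
open MeasureTheory

theorem aux_integral_eq {Ω : Type*} [MeasurableSpace Ω] (P : Measure Ω)
    (Y Yhat : Ω → Bool) (hY : Measurable Y) (hYhat : Measurable Yhat) (b : Bool) (c : ℝ)
    (f : Ω → ℝ) (hf : ∀ ω, f ω = if Y ω = b ∧ Yhat ω = b then c else 0) :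
    ∫ ω, f ω ∂P = (P {ω | Y ω = b ∧ Yhat ω = b}).toReal * c := by
  have hm : MeasurableSet {ω | Y ω = b ∧ Yhat ω = b} :=
    (hY (measurableSet_singleton b)).inter (hYhat (measurableSet_singleton b))
  have hfe : f = Set.indicator {ω | Y ω = b ∧ Yhat ω = b} (fun _ => c) := by
    funext ω
    rw [hf ω, Set.indicator_apply]
    rfl
  rw [hfe, integral_indicator_const c hm, smul_eq_mul]
  rfl

/-- If `|PD(Y=0, Ŷ=0)| + |PD(Y=1, Ŷ=1)| > 0`, then for every `K > 0` there
exist utilities `U₀₀, U₀₁, U₁₀, U₁₁` such that the resulting utility difference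
`UD = E₀[U] − E₁[U]` satisfies `UD ≥ K`.
Here `true` encodes the value `1` and `false` the value `0`, and `Yhat` is the prediction `Ŷ`. -/
theorem epsilon_fairness_can_be_maximally_unfair {Ω : Type*} [MeasurableSpace Ω]
    (P₀ P₁ : Measure Ω) [IsProbabilityMeasure P₀] [IsProbabilityMeasure P₁]
    (Y Yhat : Ω → Bool) (hY : Measurable Y) (hYhat : Measurable Yhat)
    (hPD : |(P₀ {ω | Y ω = false ∧ Yhat ω = false}).toReal
              - (P₁ {ω | Y ω = false ∧ Yhat ω = false}).toReal|
         + |(P₀ {ω | Y ω = true ∧ Yhat ω = true}).toReal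
              - (P₁ {ω | Y ω = true ∧ Yhat ω = true}).toReal| > 0) :
    ∀ K > (0 : ℝ), ∃ U₀₀ U₀₁ U₁₀ U₁₁ : ℝ,
      (∫ ω, (if Y ω then (if Yhat ω then U₁₁ else U₁₀)
             else (if Yhat ω then U₀₁ else U₀₀)) ∂P₀)
      - (∫ ω, (if Y ω then (if Yhat ω then U₁₁ else U₁₀)
             else (if Yhat ω then U₀₁ else U₀₀)) ∂P₁) ≥ K := by
  intro K _
  by_cases h : (P₀ {ω | Y ω = false ∧ Yhat ω = false}).toReal
              - (P₁ {ω | Y ω = false ∧ Yhat ω = false}).toReal = 0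
  · rw [h, abs_zero, zero_add, gt_iff_lt, abs_pos] at hPD
    refine ⟨0, 0, 0, K / ((P₀ {ω | Y ω = true ∧ Yhat ω = true}).toReal
              - (P₁ {ω | Y ω = true ∧ Yhat ω = true}).toReal), ?_⟩
    rw [aux_integral_eq P₀ Y Yhat hY hYhat true
        (K / ((P₀ {ω | Y ω = true ∧ Yhat ω = true}).toReal
          - (P₁ {ω | Y ω = true ∧ Yhat ω = true}).toReal)) _
        (fun ω => by cases Y ω <;> cases Yhat ω <;> simp),
      aux_integral_eq P₁ Y Yhat hY hYhat true
        (K / ((P₀ {ω | Y ω = true ∧ Yhat ω = true}).toReal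
          - (P₁ {ω | Y ω = true ∧ Yhat ω = true}).toReal)) _
        (fun ω => by cases Y ω <;> cases Yhat ω <;> simp),
      ← sub_mul, mul_div_cancel₀ K hPD]
  · refine ⟨K / ((P₀ {ω | Y ω = false ∧ Yhat ω = false}).toReal
              - (P₁ {ω | Y ω = false ∧ Yhat ω = false}).toReal), 0, 0, 0, ?_⟩
    rw [aux_integral_eq P₀ Y Yhat hY hYhat false
        (K / ((P₀ {ω | Y ω = false ∧ Yhat ω = false}).toReal
          - (P₁ {ω | Y ω = false ∧ Yhat ω = false}).toReal)) _
        (fun ω => by cases Y ω <;> cases Yhat ω <;> simp),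
      aux_integral_eq P₁ Y Yhat hY hYhat false
        (K / ((P₀ {ω | Y ω = false ∧ Yhat ω = false}).toReal
          - (P₁ {ω | Y ω = false ∧ Yhat ω = false}).toReal)) _
        (fun ω => by cases Y ω <;> cases Yhat ω <;> simp),
      ← sub_mul, mul_div_cancel₀ K h]
end

section
/- Assume the utility differences are bounded by K > 0, i.e., max{|U₁₁ − U₀₁|, |U₀₀ − U₁₀|, |U₀₁ − U₁₀|} ≤ K, and the probability differences are bounded by ε > 0, i.e., max{|PD(Y=1, Ŷ=1)|, |PD(Y=0, Ŷ=0)|, |PD(Ŷ=1)|} ≤ ε. Then UD ≤ 3·ε·K, i.e., there is no disadvantage larger than 3εK. -/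
open MeasureTheory

/-- If the utility differences are bounded by `K > 0` and the probability
differences are bounded by `ε > 0`, then `UD ≤ 3·ε·K`.
Here `true` encodes the value `1` and `false` the value `0`, and `Yhat` is the prediction `Ŷ`. -/
theorem no_disadvantage_larger_than_three_eps_K {Ω : Type*} [MeasurableSpace Ω]
    (P₀ P₁ : Measure Ω) [IsProbabilityMeasure P₀] [IsProbabilityMeasure P₁]
    (Y Yhat : Ω → Bool) (hY : Measurable Y) (hYhat : Measurable Yhat)
    (U₀₀ U₀₁ U₁₀ U₁₁ : ℝ) (U : Ω → ℝ)
    (hU : ∀ ω, U ω = if Y ω then (if Yhat ω then U₁₁ else U₁₀)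
                     else (if Yhat ω then U₀₁ else U₀₀))
    (UD : ℝ) (hUD : UD = (∫ ω, U ω ∂P₀) - ∫ ω, U ω ∂P₁)
    (PD : Set Ω → ℝ) (hPD : ∀ A, PD A = (P₀ A).toReal - (P₁ A).toReal)
    (K : ℝ) (hK : K > 0)
    (hUbd : max (|U₁₁ - U₀₁|) (max (|U₀₀ - U₁₀|) (|U₀₁ - U₁₀|)) ≤ K)
    (ε : ℝ) (hε : ε > 0)
    (hPbd : max (|PD {ω | Y ω = true ∧ Yhat ω = true}|)
        (max (|PD {ω | Y ω = false ∧ Yhat ω = false}|) (|PD {ω | Yhat ω = true}|)) ≤ ε) :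
    UD ≤ 3 * ε * K := by
  have hA : MeasurableSet {ω | Y ω = true ∧ Yhat ω = true} :=
    (hY (measurableSet_singleton true)).inter (hYhat (measurableSet_singleton true))
  have hB : MeasurableSet {ω | Y ω = false ∧ Yhat ω = false} :=
    (hY (measurableSet_singleton false)).inter (hYhat (measurableSet_singleton false))
  have hC : MeasurableSet {ω | Yhat ω = true} := hYhat (measurableSet_singleton true)
  have hdec : U = (fun _ => U₁₀)
      + {ω | Y ω = true ∧ Yhat ω = true}.indicator (fun _ => U₁₁ - U₀₁)
      + {ω | Y ω = false ∧ Yhat ω = false}.indicator (fun _ => U₀₀ - U₁₀)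
      + {ω | Yhat ω = true}.indicator (fun _ => U₀₁ - U₁₀) := by
    funext ω
    rw [hU]
    cases h1 : Y ω <;> cases h2 : Yhat ω <;> simp [Set.indicator, h1, h2]
    ring
  have key : ∀ (P : Measure Ω) [IsProbabilityMeasure P], ∫ ω, U ω ∂P = U₁₀
      + (P {ω | Y ω = true ∧ Yhat ω = true}).toReal * (U₁₁ - U₀₁)
      + (P {ω | Y ω = false ∧ Yhat ω = false}).toReal * (U₀₀ - U₁₀)
      + (P {ω | Yhat ω = true}).toReal * (U₀₁ - U₁₀) := by
    intro P _
    have iA := (integrable_const (μ := P) (U₁₁ - U₀₁)).indicator hA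
    have iB := (integrable_const (μ := P) (U₀₀ - U₁₀)).indicator hB
    have iC := (integrable_const (μ := P) (U₀₁ - U₁₀)).indicator hC
    have i0 := integrable_const (μ := P) U₁₀
    rw [hdec, integral_add' ((i0.add iA).add iB) iC, integral_add' (i0.add iA) iB,
      integral_add' i0 iA, integral_indicator_const _ hA, integral_indicator_const _ hB,
      integral_indicator_const _ hC]
    simp [Measure.real]
  have hmul : ∀ a b : ℝ, |a| ≤ ε → |b| ≤ K → a * b ≤ ε * K := fun a b ha hb =>
    (le_abs_self _).trans ((abs_mul a b).trans_le
      (mul_le_mul ha hb (abs_nonneg _) hε.le))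
  simp only [max_le_iff, hPD] at hUbd hPbd
  obtain ⟨u1, u2, u3⟩ := hUbd
  obtain ⟨p1, p2, p3⟩ := hPbd
  have m1 := hmul _ _ p1 u1
  have m2 := hmul _ _ p2 u2
  have m3 := hmul _ _ p3 u3
  rw [hUD, key P₀, key P₁]
  linarith
end

section
/- Assume statistical parity, i.e., P₀(Y=1) = P₁(Y=1), and equalized odds, i.e., P₀(Ŷ=i | Y=i) = P₁(Ŷ=i | Y=i) for i = 0, 1 (with P_s(Y=i) > 0 for s, i ∈ {0,1}), and assume U₀₁ = U₁₀. Then UD = 0; in particular, there is no disadvantage. -/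
open MeasureTheory

theorem integral_utility_aux {Ω : Type*} [MeasurableSpace Ω]
    (P : Measure Ω) [IsProbabilityMeasure P]
    (Y Yhat : Ω → Bool) (hY : Measurable Y) (hYhat : Measurable Yhat)
    (a b c : ℝ) (U : Ω → ℝ)
    (hU : ∀ ω, U ω = if Y ω then (if Yhat ω then c else b)
                     else (if Yhat ω then b else a)) :
    ∫ ω, U ω ∂P = b + (P {ω | Yhat ω = true ∧ Y ω = true}).toReal * (c - b)
      + (P {ω | Yhat ω = false ∧ Y ω = false}).toReal * (a - b) := by
  have hm : ∀ i : Bool, MeasurableSet {ω | Yhat ω = i ∧ Y ω = i} := fun i =>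
    (hYhat (measurableSet_singleton i)).inter (hY (measurableSet_singleton i))
  have hUe : U = fun ω => b + Set.indicator {ω | Yhat ω = true ∧ Y ω = true} (fun _ => c - b) ω
      + Set.indicator {ω | Yhat ω = false ∧ Y ω = false} (fun _ => a - b) ω := by
    funext ω
    rw [hU]
    cases h1 : Y ω <;> cases h2 : Yhat ω <;> simp [Set.indicator, h1, h2]
  have i1 := (integrable_const (μ := P) (c - b)).indicator (hm true)
  have i2 := (integrable_const (μ := P) (a - b)).indicator (hm false)
  have i3 : Integrable (fun ω => b
      + Set.indicator {ω | Yhat ω = true ∧ Y ω = true} (fun _ => c - b) ω) P :=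
    (integrable_const b).add i1
  simp only [hUe]
  rw [integral_add i3 i2, integral_add (integrable_const b) i1,
    integral_indicator_const _ (hm true), integral_indicator_const _ (hm false)]
  simp [Measure.real]

theorem measure_false_aux {Ω : Type*} [MeasurableSpace Ω]
    (P : Measure Ω) [IsProbabilityMeasure P] (Y : Ω → Bool) (hY : Measurable Y) :
    P {ω | Y ω = false} = 1 - P {ω | Y ω = true} := by
  have hm : MeasurableSet {ω | Y ω = true} := hY (measurableSet_singleton true)
  rw [← prob_compl_eq_one_sub hm]
  congr 1
  ext ω
  simp

/-- Statistical parity (`P₀(Y=1) = P₁(Y=1)`) and equalized odds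
(`P₀(Ŷ=i | Y=i) = P₁(Ŷ=i | Y=i)` for `i = 0,1`, with `P_s(Y=i) > 0`), together with
`U₀₁ = U₁₀`, imply `UD = 0`; in particular, there is no disadvantage (`UD ≤ 0`).
Here `true` encodes the value `1` and `false` the value `0`, and `Yhat` is the prediction `Ŷ`;
the conditional probability `P(A|B)` is written as `P(A ∩ B)/P(B)`. -/
theorem statistical_parity_and_equalized_odds_imply_fairness {Ω : Type*} [MeasurableSpace Ω]
    (P₀ P₁ : Measure Ω) [IsProbabilityMeasure P₀] [IsProbabilityMeasure P₁]
    (Y Yhat : Ω → Bool) (hY : Measurable Y) (hYhat : Measurable Yhat)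
    (U₀₀ U₀₁ U₁₀ U₁₁ : ℝ) (U : Ω → ℝ)
    (hU : ∀ ω, U ω = if Y ω then (if Yhat ω then U₁₁ else U₁₀)
                     else (if Yhat ω then U₀₁ else U₀₀))
    (UD : ℝ) (hUD : UD = (∫ ω, U ω ∂P₀) - ∫ ω, U ω ∂P₁)
    (hpos : ∀ i : Bool, 0 < (P₀ {ω | Y ω = i}).toReal ∧ 0 < (P₁ {ω | Y ω = i}).toReal)
    (hstatpar : P₀ {ω | Y ω = true} = P₁ {ω | Y ω = true})
    (heqodds : ∀ i : Bool,
      (P₀ {ω | Yhat ω = i ∧ Y ω = i}).toReal / (P₀ {ω | Y ω = i}).toReal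
        = (P₁ {ω | Yhat ω = i ∧ Y ω = i}).toReal / (P₁ {ω | Y ω = i}).toReal)
    (hUeq : U₀₁ = U₁₀) :
    UD = 0 ∧ UD ≤ 0 := by
  subst hUeq
  have hP : ∀ i : Bool, P₀ {ω | Y ω = i} = P₁ {ω | Y ω = i} := by
    intro i
    cases i
    · rw [measure_false_aux P₀ Y hY, measure_false_aux P₁ Y hY, hstatpar]
    · exact hstatpar
  have key : ∀ i : Bool, (P₀ {ω | Yhat ω = i ∧ Y ω = i}).toReal
      = (P₁ {ω | Yhat ω = i ∧ Y ω = i}).toReal := by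
    intro i
    have h := heqodds i
    rw [hP i] at h
    exact (div_left_inj' (hpos i).2.ne').1 h
  have h0 : UD = 0 := by
    rw [hUD, integral_utility_aux P₀ Y Yhat hY hYhat _ _ _ U hU,
      integral_utility_aux P₁ Y Yhat hY hYhat _ _ _ U hU, key true, key false, sub_self]
  exact ⟨h0, h0.le⟩
end

section
/- Assume equality of the conditional use accuracy, i.e., P₀(Y=i | Ŷ=i) = P₁(Y=i | Ŷ=i) for i = 0, 1 (with P_s(Ŷ=i) > 0 for s, i ∈ {0,1}). If moreover P₀(Ŷ=1) = P₁(Ŷ=1), then UD = 0; in particular, there is no disadvantage. -/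
open MeasureTheory

theorem expected_utility_aux {Ω : Type*} [MeasurableSpace Ω]
    (P : Measure Ω) [IsProbabilityMeasure P]
    (Y Yhat : Ω → Bool) (hY : Measurable Y) (hYhat : Measurable Yhat)
    (a b c d : ℝ) (U : Ω → ℝ)
    (hU : ∀ ω, U ω = if Y ω then (if Yhat ω then d else c)
                     else (if Yhat ω then b else a)) :
    ∫ ω, U ω ∂P = P.real {ω | Y ω = true ∧ Yhat ω = true} * (d - b)
      + P.real {ω | Yhat ω = true} * b
      + P.real {ω | Y ω = false ∧ Yhat ω = false} * (a - c)
      + P.real {ω | Yhat ω = false} * c := by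
  have mB : ∀ i : Bool, MeasurableSet {ω | Yhat ω = i} := fun i =>
    hYhat (measurableSet_singleton i)
  have mA : ∀ i : Bool, MeasurableSet {ω | Y ω = i ∧ Yhat ω = i} := fun i =>
    (hY (measurableSet_singleton i)).inter (mB i)
  have e : U = Set.indicator {ω | Y ω = true ∧ Yhat ω = true} (fun _ => d - b)
      + Set.indicator {ω | Yhat ω = true} (fun _ => b)
      + Set.indicator {ω | Y ω = false ∧ Yhat ω = false} (fun _ => a - c)
      + Set.indicator {ω | Yhat ω = false} (fun _ => c) := by
    funext ω
    rw [hU]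
    cases h1 : Y ω <;> cases h2 : Yhat ω <;> simp [Pi.add_apply, Set.indicator, h1, h2]
  have iA : ∀ (i : Bool) (r : ℝ),
      Integrable (Set.indicator {ω | Y ω = i ∧ Yhat ω = i} (fun _ => r)) P := fun i r =>
    (integrable_const r).indicator (mA i)
  have iB : ∀ (i : Bool) (r : ℝ),
      Integrable (Set.indicator {ω | Yhat ω = i} (fun _ => r)) P := fun i r =>
    (integrable_const r).indicator (mB i)
  rw [e, integral_add' (((iA _ _).add (iB _ _)).add (iA _ _)) (iB _ _),
    integral_add' ((iA _ _).add (iB _ _)) (iA _ _), integral_add' (iA _ _) (iB _ _),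
    integral_indicator_const _ (mA _), integral_indicator_const _ (mA _),
    integral_indicator_const _ (mB _), integral_indicator_const _ (mB _)]
  simp only [smul_eq_mul]

/-- Equality of the conditional use accuracy
(`P₀(Y=i | Ŷ=i) = P₁(Y=i | Ŷ=i)` for `i = 0,1`, with `P_s(Ŷ=i) > 0`) together with
`P₀(Ŷ=1) = P₁(Ŷ=1)` implies `UD = 0`; in particular, there is no disadvantage (`UD ≤ 0`).
Here `true` encodes the value `1` and `false` the value `0`, and `Yhat` is the prediction `Ŷ`;
the conditional probability `P(A|B)` is written as `P(A ∩ B)/P(B)`. -/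
theorem cua_and_demographic_parity_imply_fairness {Ω : Type*} [MeasurableSpace Ω]
    (P₀ P₁ : Measure Ω) [IsProbabilityMeasure P₀] [IsProbabilityMeasure P₁]
    (Y Yhat : Ω → Bool) (hY : Measurable Y) (hYhat : Measurable Yhat)
    (U₀₀ U₀₁ U₁₀ U₁₁ : ℝ) (U : Ω → ℝ)
    (hU : ∀ ω, U ω = if Y ω then (if Yhat ω then U₁₁ else U₁₀)
                     else (if Yhat ω then U₀₁ else U₀₀))
    (UD : ℝ) (hUD : UD = (∫ ω, U ω ∂P₀) - ∫ ω, U ω ∂P₁)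
    (hpos : ∀ i : Bool, 0 < (P₀ {ω | Yhat ω = i}).toReal ∧ 0 < (P₁ {ω | Yhat ω = i}).toReal)
    (hcua : ∀ i : Bool,
      (P₀ {ω | Y ω = i ∧ Yhat ω = i}).toReal / (P₀ {ω | Yhat ω = i}).toReal
        = (P₁ {ω | Y ω = i ∧ Yhat ω = i}).toReal / (P₁ {ω | Yhat ω = i}).toReal)
    (hdempar : P₀ {ω | Yhat ω = true} = P₁ {ω | Yhat ω = true}) :
    UD = 0 ∧ UD ≤ 0 := by
  have hc : ∀ (P : Measure Ω) [IsProbabilityMeasure P],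
      P.real {ω | Yhat ω = false} = 1 - P.real {ω | Yhat ω = true} := by
    intro P _
    have m : MeasurableSet {ω | Yhat ω = true} := hYhat (measurableSet_singleton true)
    rw [← probReal_compl_eq_one_sub m]
    congr 1
    ext ω
    simp
  have hB1 : P₀.real {ω | Yhat ω = true} = P₁.real {ω | Yhat ω = true} := by
    simp only [Measure.real, hdempar]
  have hB : ∀ i : Bool, P₀.real {ω | Yhat ω = i} = P₁.real {ω | Yhat ω = i} := by
    intro i
    cases i
    · rw [hc P₀, hc P₁, hB1]
    · exact hB1
  have hA : ∀ i : Bool, P₀.real {ω | Y ω = i ∧ Yhat ω = i}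
      = P₁.real {ω | Y ω = i ∧ Yhat ω = i} := by
    intro i
    have h := hcua i
    have h2 := hB i
    simp only [Measure.real] at h2 ⊢
    rw [h2] at h
    exact (div_left_inj' (hpos i).2.ne').1 h
  have h0 : UD = 0 := by
    rw [hUD, expected_utility_aux P₀ Y Yhat hY hYhat _ _ _ _ U hU,
      expected_utility_aux P₁ Y Yhat hY hYhat _ _ _ _ U hU, hA, hA, hB, hB, sub_self]
  exact ⟨h0, h0.le⟩
end

section
/- Assume equality of the conditional use accuracy, i.e., P₀(Y=i | Ŷ=i) = P₁(Y=i | Ŷ=i) for i = 0, 1 (with P_s(Ŷ=i) > 0 for s, i ∈ {0,1}), that the utility differences are bounded by K > 0, i.e., max{|U₁₁ − U₀₁|, |U₀₀ − U₁₀|, |U₀₁ − U₁₀|} ≤ K, and that |P₀(Ŷ=1) − P₁(Ŷ=1)| ≤ ε for some ε > 0. Let Γ = max{P₀(Y=1 | Ŷ=1), P₀(Y=0 | Ŷ=0)}. Then UD ≤ (1 + 2Γ)·ε·K, i.e., there is no disadvantage larger than (1+2Γ)εK. -/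
open MeasureTheory

theorem cua_expectation {Ω : Type*} [MeasurableSpace Ω]
    (P : Measure Ω) [IsProbabilityMeasure P]
    (Y Yhat : Ω → Bool) (hY : Measurable Y) (hYhat : Measurable Yhat)
    (U₀₀ U₀₁ U₁₀ U₁₁ : ℝ) (U : Ω → ℝ)
    (hU : ∀ ω, U ω = if Y ω then (if Yhat ω then U₁₁ else U₁₀)
                     else (if Yhat ω then U₀₁ else U₀₀)) :
    ∫ ω, U ω ∂P = U₁₀ + (P {ω | Yhat ω = true}).toReal * (U₀₁ - U₁₀)
      + (P {ω | Y ω = true ∧ Yhat ω = true}).toReal * (U₁₁ - U₀₁)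
      + (P {ω | Y ω = false ∧ Yhat ω = false}).toReal * (U₀₀ - U₁₀) := by
  have m1 : MeasurableSet {ω | Yhat ω = true} := hYhat (measurableSet_singleton true)
  have m2 : MeasurableSet {ω | Y ω = true ∧ Yhat ω = true} :=
    (hY (measurableSet_singleton true)).inter m1
  have m3 : MeasurableSet {ω | Y ω = false ∧ Yhat ω = false} :=
    (hY (measurableSet_singleton false)).inter (hYhat (measurableSet_singleton false))
  have e : U = fun ω => U₁₀ + {ω | Yhat ω = true}.indicator (fun _ => U₀₁ - U₁₀) ω
      + {ω | Y ω = true ∧ Yhat ω = true}.indicator (fun _ => U₁₁ - U₀₁) ω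
      + {ω | Y ω = false ∧ Yhat ω = false}.indicator (fun _ => U₀₀ - U₁₀) ω := by
    funext ω
    rw [hU]
    cases h1 : Y ω <;> cases h2 : Yhat ω <;> simp [Set.indicator, h1, h2]
  have i1 := (integrable_const (μ := P) (U₀₁ - U₁₀)).indicator m1
  have i2 := (integrable_const (μ := P) (U₁₁ - U₀₁)).indicator m2
  have i3 := (integrable_const (μ := P) (U₀₀ - U₁₀)).indicator m3
  have i0 := integrable_const (μ := P) U₁₀
  have h3 := integral_add' ((i0.add i1).add i2) i3
  rw [integral_add' (i0.add i1) i2, integral_add' i0 i1, integral_indicator_const _ m1,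
    integral_indicator_const _ m2, integral_indicator_const _ m3] at h3
  rw [e]
  refine Eq.trans h3 ?_
  simp [Measure.real]

/-- Under equality of the conditional use accuracy, if the utility differences
are bounded by `K > 0` and `|P₀(Ŷ=1) − P₁(Ŷ=1)| ≤ ε` for some `ε > 0`, then with
`Γ = max{P₀(Y=1 | Ŷ=1), P₀(Y=0 | Ŷ=0)}` we have `UD ≤ (1 + 2Γ)·ε·K`.
Here `true` encodes the value `1` and `false` the value `0`, and `Yhat` is the prediction `Ŷ`;
the conditional probability `P(A|B)` is written as `P(A ∩ B)/P(B)`. -/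
theorem cua_bound_on_disadvantage {Ω : Type*} [MeasurableSpace Ω]
    (P₀ P₁ : Measure Ω) [IsProbabilityMeasure P₀] [IsProbabilityMeasure P₁]
    (Y Yhat : Ω → Bool) (hY : Measurable Y) (hYhat : Measurable Yhat)
    (U₀₀ U₀₁ U₁₀ U₁₁ : ℝ) (U : Ω → ℝ)
    (hU : ∀ ω, U ω = if Y ω then (if Yhat ω then U₁₁ else U₁₀)
                     else (if Yhat ω then U₀₁ else U₀₀))
    (UD : ℝ) (hUD : UD = (∫ ω, U ω ∂P₀) - ∫ ω, U ω ∂P₁)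
    (hpos : ∀ i : Bool, 0 < (P₀ {ω | Yhat ω = i}).toReal ∧ 0 < (P₁ {ω | Yhat ω = i}).toReal)
    (hcua : ∀ i : Bool,
      (P₀ {ω | Y ω = i ∧ Yhat ω = i}).toReal / (P₀ {ω | Yhat ω = i}).toReal
        = (P₁ {ω | Y ω = i ∧ Yhat ω = i}).toReal / (P₁ {ω | Yhat ω = i}).toReal)
    (K : ℝ) (hK : K > 0)
    (hUbd : max (|U₁₁ - U₀₁|) (max (|U₀₀ - U₁₀|) (|U₀₁ - U₁₀|)) ≤ K)
    (ε : ℝ) (hε : ε > 0)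
    (hPbd : |(P₀ {ω | Yhat ω = true}).toReal - (P₁ {ω | Yhat ω = true}).toReal| ≤ ε)
    (Γ : ℝ)
    (hΓ : Γ = max
      ((P₀ {ω | Y ω = true ∧ Yhat ω = true}).toReal / (P₀ {ω | Yhat ω = true}).toReal)
      ((P₀ {ω | Y ω = false ∧ Yhat ω = false}).toReal / (P₀ {ω | Yhat ω = false}).toReal)) :
    UD ≤ (1 + 2 * Γ) * ε * K := by
  have hq : ∀ (P : Measure Ω) [IsProbabilityMeasure P],
      (P {ω | Yhat ω = false}).toReal = 1 - (P {ω | Yhat ω = true}).toReal := by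
    intro P _
    have m1 : MeasurableSet {ω | Yhat ω = true} := hYhat (measurableSet_singleton true)
    have h := probReal_compl_eq_one_sub (μ := P) m1
    have e : {ω | Yhat ω = true}ᶜ = {ω | Yhat ω = false} := by ext ω; simp
    rw [e] at h
    exact h
  have E0 := cua_expectation P₀ Y Yhat hY hYhat U₀₀ U₀₁ U₁₀ U₁₁ U hU
  have E1 := cua_expectation P₁ Y Yhat hY hYhat U₀₀ U₀₁ U₁₀ U₁₁ U hU
  have ht := hcua true
  have hf := hcua false
  obtain ⟨p0t, p1t⟩ := hpos true
  obtain ⟨p0f, p1f⟩ := hpos false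
  have a0 : 0 ≤ (P₀ {ω | Y ω = true ∧ Yhat ω = true}).toReal /
    (P₀ {ω | Yhat ω = true}).toReal := by positivity
  have b0 : 0 ≤ (P₀ {ω | Y ω = false ∧ Yhat ω = false}).toReal /
    (P₀ {ω | Yhat ω = false}).toReal := by positivity
  have A0 := div_mul_cancel₀ (P₀ {ω | Y ω = true ∧ Yhat ω = true}).toReal p0t.ne'
  have B0 := div_mul_cancel₀ (P₀ {ω | Y ω = false ∧ Yhat ω = false}).toReal p0f.ne'
  have A1 := div_mul_cancel₀ (P₁ {ω | Y ω = true ∧ Yhat ω = true}).toReal p1t.ne'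
  have B1 := div_mul_cancel₀ (P₁ {ω | Y ω = false ∧ Yhat ω = false}).toReal p1f.ne'
  rw [← ht] at A1
  rw [← hf] at B1
  have la := le_max_left ((P₀ {ω | Y ω = true ∧ Yhat ω = true}).toReal /
    (P₀ {ω | Yhat ω = true}).toReal) ((P₀ {ω | Y ω = false ∧ Yhat ω = false}).toReal /
    (P₀ {ω | Yhat ω = false}).toReal)
  have lb := le_max_right ((P₀ {ω | Y ω = true ∧ Yhat ω = true}).toReal /
    (P₀ {ω | Yhat ω = true}).toReal) ((P₀ {ω | Y ω = false ∧ Yhat ω = false}).toReal /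
    (P₀ {ω | Yhat ω = false}).toReal)
  rw [← hΓ] at la lb
  rw [E0, E1, ← A0, ← A1, ← B0, ← B1] at hUD
  clear A0 A1 B0 B1 ht hf hcua E0 E1 hΓ
  generalize (P₀ {ω | Y ω = true ∧ Yhat ω = true}).toReal /
    (P₀ {ω | Yhat ω = true}).toReal = a at *
  generalize (P₀ {ω | Y ω = false ∧ Yhat ω = false}).toReal /
    (P₀ {ω | Yhat ω = false}).toReal = b at *
  rw [hq P₀, hq P₁] at hUD
  generalize (P₀ {ω | Yhat ω = true}).toReal = q0 at *
  generalize (P₁ {ω | Yhat ω = true}).toReal = q1 at *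
  have e : UD = (q0 - q1) * ((U₀₁ - U₁₀) + a * (U₁₁ - U₀₁) - b * (U₀₀ - U₁₀)) := by
    rw [hUD]; ring
  obtain ⟨h1, h23⟩ := max_le_iff.1 hUbd
  obtain ⟨h2, h3⟩ := max_le_iff.1 h23
  have hB : |(U₀₁ - U₁₀) + a * (U₁₁ - U₀₁) - b * (U₀₀ - U₁₀)| ≤ (1 + 2 * Γ) * K := by
    rw [abs_le] at *
    constructor <;> nlinarith
  calc UD ≤ |UD| := le_abs_self _
    _ = |q0 - q1| * |(U₀₁ - U₁₀) + a * (U₁₁ - U₀₁) - b * (U₀₀ - U₁₀)| := by rw [e, abs_mul]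
    _ ≤ ε * ((1 + 2 * Γ) * K) := mul_le_mul hPbd hB (abs_nonneg _) hε.le
    _ = (1 + 2 * Γ) * ε * K := by ring
end

section
/- In the reduced setting (U₀₀ = U₁₀ = U₀), assume equality of the (conditional) use accuracy: P₀(Y=1 | Ŷ=1) = P₁(Y=1 | Ŷ=1) (with P_s(Ŷ=1) > 0 for s ∈ {0,1}) and P₀(Ŷ=0) = P₁(Ŷ=0). Then UD = 0; in particular, there is no disadvantage. -/
open MeasureTheory

lemma integral_reduced_utility {Ω : Type*} [MeasurableSpace Ω]
    (P : Measure Ω) [IsProbabilityMeasure P]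
    (Y Yhat : Ω → Bool) (hY : Measurable Y) (hYhat : Measurable Yhat)
    (a b c : ℝ) (U : Ω → ℝ)
    (hU : ∀ ω, U ω = if Y ω then (if Yhat ω then c else a)
                     else (if Yhat ω then b else a)) :
    ∫ ω, U ω ∂P = a + (b - a) * (P {ω | Yhat ω = true}).toReal
      + (c - b) * (P {ω | Y ω = true ∧ Yhat ω = true}).toReal := by
  have hA : MeasurableSet {ω | Yhat ω = true} := hYhat (measurableSet_singleton true)
  have hB : MeasurableSet {ω | Y ω = true ∧ Yhat ω = true} :=
    (hY (measurableSet_singleton true)).inter hA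
  have hf : U = fun ω => (a + {ω | Yhat ω = true}.indicator (fun _ => b - a) ω)
      + {ω | Y ω = true ∧ Yhat ω = true}.indicator (fun _ => c - b) ω := by
    funext ω
    rw [hU]
    cases h1 : Y ω <;> cases h2 : Yhat ω <;> simp [Set.indicator, h1, h2]
  have iA : Integrable ({ω | Yhat ω = true}.indicator (fun _ => b - a)) P :=
    (integrable_const _).indicator hA
  have iB : Integrable ({ω | Y ω = true ∧ Yhat ω = true}.indicator (fun _ => c - b)) P :=
    (integrable_const _).indicator hB
  have iC : Integrable (fun ω => a + {ω | Yhat ω = true}.indicator (fun _ => b - a) ω) P :=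
    (integrable_const a).add iA
  rw [hf, integral_add iC iB, integral_add (integrable_const a) iA,
    integral_indicator_const _ hA, integral_indicator_const _ hB]
  simp [Measure.real, mul_comm]

/-- In the reduced setting (`U₀₀ = U₁₀ = U₀`), equality of the (conditional)
use accuracy, i.e. `P₀(Y=1 | Ŷ=1) = P₁(Y=1 | Ŷ=1)` (with `P_s(Ŷ=1) > 0`) and
`P₀(Ŷ=0) = P₁(Ŷ=0)`, implies `UD = 0`; in particular, there is no disadvantage (`UD ≤ 0`).
Here `true` encodes the value `1` and `false` the value `0`, and `Yhat` is the prediction `Ŷ`;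
the conditional probability `P(A|B)` is written as `P(A ∩ B)/P(B)`. -/
theorem reduced_cua_implies_fairness {Ω : Type*} [MeasurableSpace Ω]
    (P₀ P₁ : Measure Ω) [IsProbabilityMeasure P₀] [IsProbabilityMeasure P₁]
    (Y Yhat : Ω → Bool) (hY : Measurable Y) (hYhat : Measurable Yhat)
    (U₀₀ U₀₁ U₁₀ U₁₁ U₀ : ℝ) (hred : U₀₀ = U₀ ∧ U₁₀ = U₀)
    (U : Ω → ℝ)
    (hU : ∀ ω, U ω = if Y ω then (if Yhat ω then U₁₁ else U₁₀)
                     else (if Yhat ω then U₀₁ else U₀₀))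
    (UD : ℝ) (hUD : UD = (∫ ω, U ω ∂P₀) - ∫ ω, U ω ∂P₁)
    (hpos : 0 < (P₀ {ω | Yhat ω = true}).toReal ∧ 0 < (P₁ {ω | Yhat ω = true}).toReal)
    (hcua : (P₀ {ω | Y ω = true ∧ Yhat ω = true}).toReal / (P₀ {ω | Yhat ω = true}).toReal
        = (P₁ {ω | Y ω = true ∧ Yhat ω = true}).toReal / (P₁ {ω | Yhat ω = true}).toReal)
    (hzero : P₀ {ω | Yhat ω = false} = P₁ {ω | Yhat ω = false}) :
    UD = 0 ∧ UD ≤ 0 := by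
  obtain ⟨h00, h10⟩ := hred
  subst h00
  subst h10
  have hset : {ω | Yhat ω = true} = {ω | Yhat ω = false}ᶜ := by
    ext ω
    simp
  have hF : MeasurableSet {ω | Yhat ω = false} := hYhat (measurableSet_singleton false)
  have hone : P₀ {ω | Yhat ω = true} = P₁ {ω | Yhat ω = true} := by
    rw [hset, prob_compl_eq_one_sub hF, prob_compl_eq_one_sub hF, hzero]
  have hboth : (P₀ {ω | Y ω = true ∧ Yhat ω = true}).toReal
      = (P₁ {ω | Y ω = true ∧ Yhat ω = true}).toReal := by
    rw [hone] at hcua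
    exact (div_left_inj' hpos.2.ne').mp hcua
  have h : UD = 0 := by
    rw [hUD, integral_reduced_utility P₀ Y Yhat hY hYhat _ _ _ U hU,
      integral_reduced_utility P₁ Y Yhat hY hYhat _ _ _ U hU, hone, hboth, sub_self]
  exact ⟨h, h.le⟩
end

section
/- In the reduced setting (U₀₀ = U₁₀ = U₀), assume U₁₁ − U₀₁ ≥ 0 and U₀₁ − U₀ ≥ 0, and suppose the probabilities lie in uncertainty intervals: for s ∈ {0,1}, π̲_s ≤ P_s(Y=1, Ŷ=1) ≤ π̄_s and π̲'_s ≤ P_s(Ŷ=1) ≤ π̄'_s. Then the utility difference satisfies UD ≤ (U₁₁ − U₀₁)·(π̄₀ − π̲₁) + (U₀₁ − U₀)·(π̄'₀ − π̲'₁). -/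
open MeasureTheory

/-- In the reduced setting (`U₀₀ = U₁₀ = U₀`), assume `U₁₁ − U₀₁ ≥ 0` and
`U₀₁ − U₀ ≥ 0`, and that probabilities lie in uncertainty intervals, for `s ∈ {0,1}`:
`π̲_s ≤ P_s(Y=1, Ŷ=1) ≤ π̄_s` and `π̲'_s ≤ P_s(Ŷ=1) ≤ π̄'_s`. Then
`UD ≤ (U₁₁ − U₀₁)·(π̄₀ − π̲₁) + (U₀₁ − U₀)·(π̄'₀ − π̲'₁)`.
Here `true` encodes the value `1` and `false` the value `0`, and `Yhat` is the prediction `Ŷ`;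
`πlo`, `πhi`, `πlo'`, `πhi'` are the interval bounds `π̲`, `π̄`, `π̲'`, `π̄'`. -/
theorem uncertainty_upper_bound_on_utility_difference {Ω : Type*} [MeasurableSpace Ω]
    (P₀ P₁ : Measure Ω) [IsProbabilityMeasure P₀] [IsProbabilityMeasure P₁]
    (Y Yhat : Ω → Bool) (hY : Measurable Y) (hYhat : Measurable Yhat)
    (U₀₀ U₀₁ U₁₀ U₁₁ U₀ : ℝ) (hred : U₀₀ = U₀ ∧ U₁₀ = U₀)
    (U : Ω → ℝ)
    (hU : ∀ ω, U ω = if Y ω then (if Yhat ω then U₁₁ else U₁₀)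
                     else (if Yhat ω then U₀₁ else U₀₀))
    (UD : ℝ) (hUD : UD = (∫ ω, U ω ∂P₀) - ∫ ω, U ω ∂P₁)
    (hU1 : U₁₁ - U₀₁ ≥ 0) (hU2 : U₀₁ - U₀ ≥ 0)
    (πlo₀ πhi₀ πlo₁ πhi₁ πlo'₀ πhi'₀ πlo'₁ πhi'₁ : ℝ)
    (h0 : πlo₀ ≤ (P₀ {ω | Y ω = true ∧ Yhat ω = true}).toReal
        ∧ (P₀ {ω | Y ω = true ∧ Yhat ω = true}).toReal ≤ πhi₀)
    (h1 : πlo₁ ≤ (P₁ {ω | Y ω = true ∧ Yhat ω = true}).toReal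
        ∧ (P₁ {ω | Y ω = true ∧ Yhat ω = true}).toReal ≤ πhi₁)
    (h0' : πlo'₀ ≤ (P₀ {ω | Yhat ω = true}).toReal
        ∧ (P₀ {ω | Yhat ω = true}).toReal ≤ πhi'₀)
    (h1' : πlo'₁ ≤ (P₁ {ω | Yhat ω = true}).toReal
        ∧ (P₁ {ω | Yhat ω = true}).toReal ≤ πhi'₁) :
    UD ≤ (U₁₁ - U₀₁) * (πhi₀ - πlo₁) + (U₀₁ - U₀) * (πhi'₀ - πlo'₁) := by
  have hA : MeasurableSet {ω | Y ω = true ∧ Yhat ω = true} :=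
    (hY (measurableSet_singleton true)).inter (hYhat (measurableSet_singleton true))
  have hB : MeasurableSet {ω | Yhat ω = true} := hYhat (measurableSet_singleton true)
  have key : ∀ (P : Measure Ω) [IsProbabilityMeasure P], ∫ ω, U ω ∂P
      = (U₁₁ - U₀₁) * (P {ω | Y ω = true ∧ Yhat ω = true}).toReal
        + (U₀₁ - U₀) * (P {ω | Yhat ω = true}).toReal + U₀ := by
    intro P _
    have hf : U = fun ω =>
        ({ω | Y ω = true ∧ Yhat ω = true}.indicator (fun _ => U₁₁ - U₀₁)
          + {ω | Yhat ω = true}.indicator (fun _ => U₀₁ - U₀)) ω + U₀ := by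
      funext ω
      rw [hU, hred.1, hred.2]
      cases h : Y ω <;> cases h' : Yhat ω <;> simp [Set.indicator, h, h']
    have i1 : Integrable ({ω | Y ω = true ∧ Yhat ω = true}.indicator
        (fun _ => U₁₁ - U₀₁)) P := (integrable_const _).indicator hA
    have i2 : Integrable ({ω | Yhat ω = true}.indicator (fun _ => U₀₁ - U₀)) P :=
      (integrable_const _).indicator hB
    rw [hf, integral_add (i1.add i2) (integrable_const _), integral_add' i1 i2,
      integral_indicator_const _ hA, integral_indicator_const _ hB]
    simp [Measure.real, mul_comm]
  rw [hUD, key P₀, key P₁]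
  have a := mul_le_mul_of_nonneg_left (sub_le_sub h0.2 h1.1) hU1
  have b := mul_le_mul_of_nonneg_left (sub_le_sub h0'.2 h1'.1) hU2
  linarith
end
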